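/- arXiv:1211.1001 — 2 statements merged into one kernel-verified Lean document; each statement's English description precedes it below -/
import Mathlib

section
/- (Claim 5.1) Let f : {−1,1}ⁿ → ℝ and for i ∈ {1,…,n} let S_i = {i+1,…,n}. Then Δ_n(f) = Σ_{i=1}^{n} E_{X ∈ {−1,1}^{S_i}} |(f_X)^(i)|³, where X is uniform on {−1,1}^{S_i}, f_X : {−1,1}^{{1,…,i}} → ℝ is the restriction of f obtained by fixing the coordinates in S_i to X, and (f_X)^(i) denotes the Fourier coefficient of f_X at the singleton set {i}. -/
noncomputable section
namespace DMN

/-- The real sign of a boolean bit: `true ↦ 1`, `false ↦ -1`. -/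
def sgn (b : Bool) : ℝ := if b then 1 else -1

/-- The character `χ_S(x) = ∏_{i ∈ S} x_i` on the discrete cube. -/
def chi {n : ℕ} (S : Finset (Fin n)) (x : Fin n → Bool) : ℝ := ∏ i ∈ S, sgn (x i)

/-- Expectation over the uniform measure on `{-1,1}^n`. -/
def cubeE {n : ℕ} (f : (Fin n → Bool) → ℝ) : ℝ := (∑ x, f x) / 2 ^ n

/-- Fourier coefficient `f̂(S) = E[f · χ_S]`. -/
def fhat {n : ℕ} (f : (Fin n → Bool) → ℝ) (S : Finset (Fin n)) : ℝ :=
  cubeE fun x => f x * chi S x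

/-- `Δ₁(g) = E|g - E g|³` for `g : {-1,1} → ℝ` (uniform measure on one bit). -/
def Delta1Cube (g : Bool → ℝ) : ℝ :=
  (∑ b : Bool, |g b - (∑ b' : Bool, g b') / 2| ^ 3) / 2

/-- The recursively defined functional `Δ_n` on the discrete cube:
`Δ_n(f) = E_{X_n}[Δ_{n-1}(f_{X_n})] + Δ₁(E[f_{X_n} | X_n])`, with `Δ_0 = 0`. -/
def DeltaCube : (n : ℕ) → ((Fin n → Bool) → ℝ) → ℝ
  | 0, _ => 0
  | n + 1, f =>
      (∑ b : Bool, DeltaCube n fun z => f (Fin.snoc z b)) / 2 +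
        Delta1Cube fun b => cubeE fun z => f (Fin.snoc z b)

/-- Fourier coefficient at `U` of the restriction `f_x` of `f` fixing the coordinates
in `S` to the values of `x` (only the values of `x` on `S` matter, and the average over
`y` only depends on the free coordinates, so the full-cube average below agrees with the
expectation over `{-1,1}^{[n]∖S}`). -/
def fourierRestrict {n : ℕ} (f : (Fin n → Bool) → ℝ) (S : Finset (Fin n))
    (x : Fin n → Bool) (U : Finset (Fin n)) : ℝ :=
  cubeE fun y => f (fun j => if j ∈ S then x j else y j) * chi U y

lemma cubeE_succ {n : ℕ} (f : (Fin (n + 1) → Bool) → ℝ) :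
    cubeE f = (∑ b : Bool, cubeE fun z => f (Fin.snoc z b)) / 2 := by
  have h : ∑ x, f x = ∑ b : Bool, ∑ z : Fin n → Bool, f (Fin.snoc z b) := by
    rw [← (Fin.snocEquiv fun _ : Fin (n + 1) => Bool).sum_comp f, Fintype.sum_prod_type]
    rfl
  simp only [cubeE, h, ← Finset.sum_div, pow_succ]
  rw [div_div]

lemma cubeE_const (n : ℕ) (c : ℝ) : cubeE (fun _ : Fin n → Bool => c) = c := by
  simp [cubeE]

lemma cubeE_mul_right {n : ℕ} (f : (Fin n → Bool) → ℝ) (c : ℝ) :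
    cubeE (fun x => f x * c) = cubeE f * c := by
  rw [cubeE, cubeE, ← Finset.sum_mul, div_mul_eq_mul_div]

/-- For a function of one bit, `Δ₁` is the cube of the absolute value of its degree one
Fourier coefficient. -/
lemma Delta1Cube_eq (g : Bool → ℝ) :
    Delta1Cube g = |(∑ b : Bool, g b * sgn b) / 2| ^ 3 := by
  have h₁ : g true - (g true + g false) / 2 = (g true - g false) / 2 := by ring
  have h₂ : g false - (g true + g false) / 2 = -((g true - g false) / 2) := by ring
  have h₃ : (g true * 1 + g false * -1) / 2 = (g true - g false) / 2 := by ring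
  simp only [Delta1Cube, sgn, Fintype.sum_bool, if_true, Bool.false_eq_true, if_false,
    h₁, h₂, h₃, abs_neg]
  ring

/-- When the last coordinate is fixed, restricting is the same as first fixing the last
coordinate and then restricting the resulting function of `n` variables. -/
lemma fourierRestrict_snoc_castSucc {n : ℕ} (f : (Fin (n + 1) → Bool) → ℝ) (k : Fin n)
    (X : Fin n → Bool) (b : Bool) :
    fourierRestrict f (Finset.univ.filter fun j => k.castSucc < j) (Fin.snoc X b)
        {k.castSucc} =
      fourierRestrict (fun z => f (Fin.snoc z b)) (Finset.univ.filter fun j => k < j) X {k} := by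
  have h (y : Fin n → Bool) (c : Bool) :
      (fun j => if j ∈ Finset.univ.filter (fun j => k.castSucc < j)
          then (Fin.snoc X b : Fin (n + 1) → Bool) j else (Fin.snoc y c : Fin (n + 1) → Bool) j) =
        (Fin.snoc (fun j => if j ∈ Finset.univ.filter (fun j => k < j) then X j else y j) b :
          Fin (n + 1) → Bool) := by
    funext j
    refine Fin.lastCases ?_ (fun i => ?_) j
    · simp [Fin.castSucc_lt_last]
    · simp
  simp only [fourierRestrict]
  rw [cubeE_succ]
  simp only [h, chi, Finset.prod_singleton, Fin.snoc_castSucc, Fintype.sum_bool]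
  ring

lemma fourierRestrict_last {n : ℕ} (f : (Fin (n + 1) → Bool) → ℝ) (X : Fin (n + 1) → Bool) :
    fourierRestrict f (Finset.univ.filter fun j => Fin.last n < j) X {Fin.last n} =
      (∑ b : Bool, (cubeE fun z => f (Fin.snoc z b)) * sgn b) / 2 := by
  have h (j : Fin (n + 1)) : ¬ Fin.last n < j := not_lt.mpr j.le_last
  simp only [fourierRestrict]
  rw [cubeE_succ]
  simp only [Finset.mem_filter, Finset.mem_univ, true_and, h, if_false, chi,
    Finset.prod_singleton, Fin.snoc_last, cubeE_mul_right]

/-- **Claim 5.1**: `Δ_n(f) = Σ_{i=1}^n E_{X ∈ {-1,1}^{S_i}} |(f_X)^({i})|³`, where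
`S_i = {i+1, …, n}` (in 0-based indexing, for each `k : Fin n` the coordinates `> k`
are fixed and the Fourier coefficient is taken at the singleton `{k}`). -/
theorem DeltaCube_eq_sum_restrict (n : ℕ) (f : (Fin n → Bool) → ℝ) :
    DeltaCube n f =
      ∑ k : Fin n, cubeE fun X =>
        |fourierRestrict f (Finset.univ.filter fun j => k < j) X {k}| ^ 3 := by
  induction n with
  | zero => simp [DeltaCube]
  | succ n ih =>
    rw [DeltaCube, Fin.sum_univ_castSucc, Delta1Cube_eq]
    simp only [fourierRestrict_last, cubeE_const, ih]
    congr 1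
    rw [Finset.sum_comm, Finset.sum_div]
    refine Finset.sum_congr rfl fun k _ => ?_
    rw [cubeE_succ]
    simp only [fourierRestrict_snoc_castSucc]

end DMN
end
end

section
/- (Claim B.1, polynomial approximation of J_ρ) For any ρ ∈ (−1,1), any ε ∈ (0, 1/2), and any δ > 0, there is a real polynomial J̃ in two variables such that for all integers i, j ≥ 0 with 0 ≤ i + j ≤ 2, sup_{x,y ∈ [ε,1−ε]} |∂^{i+j}J_ρ(x,y)/∂xⁱ∂yʲ − ∂^{i+j}J̃(x,y)/∂xⁱ∂yʲ| ≤ δ. Moreover, there exist bounds D(ε,δ) and K(ε,δ), depending only on ε and δ, such that whenever ρ ∈ [−1+ε, 1−ε], the polynomial J̃ can be chosen with degree at most D(ε,δ) and all coefficients of absolute value at most K(ε,δ). -/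
open MeasureTheory

noncomputable section
namespace DMN

/-- The standard normal CDF `Φ`. -/
def Phi (t : ℝ) : ℝ := ∫ s in Set.Iic t, Real.exp (-s ^ 2 / 2) / Real.sqrt (2 * Real.pi)

/-- The inverse of the standard normal CDF. -/
def PhiInv : ℝ → ℝ := Function.invFun Phi

/-- `J_ρ(x,y) = P[X ≤ Φ⁻¹(x), Y ≤ Φ⁻¹(y)]` for a centered bivariate Gaussian `(X,Y)`
with unit variances and covariance `ρ`, extended continuously to the boundary of
`[0,1]²`. -/
def J (ρ x y : ℝ) : ℝ :=
  if x = 0 ∨ y = 0 then 0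
  else if x = 1 then y
  else if y = 1 then x
  else
    ∫ s in Set.Iic (PhiInv x), ∫ t in Set.Iic (PhiInv y),
      Real.exp (-(s ^ 2 - 2 * ρ * s * t + t ^ 2) / (2 * (1 - ρ ^ 2))) /
        (2 * Real.pi * Real.sqrt (1 - ρ ^ 2))

/-- Partial derivative in the first variable. -/
def pdx (F : ℝ → ℝ → ℝ) : ℝ → ℝ → ℝ := fun x y => deriv (fun x' => F x' y) x

/-- Partial derivative in the second variable. -/
def pdy (F : ℝ → ℝ → ℝ) : ℝ → ℝ → ℝ := fun x y => deriv (fun y' => F x y') y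

/-- Evaluation of a bivariate polynomial as a function `ℝ → ℝ → ℝ`. -/
def polyEval (p : MvPolynomial (Fin 2) ℝ) : ℝ → ℝ → ℝ :=
  fun x y => MvPolynomial.eval ![x, y] p

/-- The polynomial `p` approximates `J_ρ`, together with its partial derivatives up to
second order, within `δ` uniformly on `[ε, 1-ε]²`. -/
def ApproxJ (ρ ε δ : ℝ) (p : MvPolynomial (Fin 2) ℝ) : Prop :=
  ∀ i j : ℕ, i + j ≤ 2 → ∀ x ∈ Set.Icc ε (1 - ε), ∀ y ∈ Set.Icc ε (1 - ε),
    |(pdx^[i] (pdy^[j] (J ρ))) x y - (pdx^[i] (pdy^[j] (polyEval p))) x y| ≤ δ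

/-! ### Polynomial approximation with mixed derivatives -/

open Set in
lemma abs_le_of_hasDerivAt {a b η θ : ℝ} {e e' : ℝ → ℝ}
    (he : ∀ x ∈ Icc a b, HasDerivAt e (e' x) x) (hb : ∀ x ∈ Icc a b, |e' x| ≤ η)
    (ha : |e a| ≤ θ) : ∀ x ∈ Icc a b, |e x| ≤ θ + η * (b - a) := by
  intro x hx
  have h := norm_image_sub_le_of_norm_deriv_le_segment'
    (fun z hz => (he z hz).hasDerivWithinAt) (fun z hz => hb z (Ico_subset_Icc_self hz)) x hx
  rw [Real.norm_eq_abs] at h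
  have hη : 0 ≤ η := (abs_nonneg _).trans (hb x hx)
  have h2 : η * (x - a) ≤ η * (b - a) := by
    have := hx.2
    gcongr
  have h3 := abs_sub_abs_le_abs_sub (e x) (e a)
  linarith

lemma hasDerivAt_polyEval_fst (p : MvPolynomial (Fin 2) ℝ) (x y : ℝ) :
    HasDerivAt (fun x' => polyEval p x' y) (polyEval (MvPolynomial.pderiv 0 p) x y) x := by
  unfold polyEval
  induction p using MvPolynomial.induction_on with
  | C a => simpa using hasDerivAt_const x a
  | add p q hp hq => simpa using hp.fun_add hq
  | mul_X p i hp =>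
    have hi : HasDerivAt (fun x' : ℝ => (![x', y] : Fin 2 → ℝ) i)
        (MvPolynomial.eval ![x, y] (MvPolynomial.pderiv 0 (MvPolynomial.X i))) x := by
      fin_cases i
      · simpa using hasDerivAt_id' x
      · simpa [MvPolynomial.pderiv_X] using hasDerivAt_const x y
    simpa [Derivation.leibniz, add_comm, mul_comm] using hi.fun_mul hp

lemma hasDerivAt_polyEval_snd (p : MvPolynomial (Fin 2) ℝ) (x y : ℝ) :
    HasDerivAt (fun y' => polyEval p x y') (polyEval (MvPolynomial.pderiv 1 p) x y) y := by
  unfold polyEval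
  induction p using MvPolynomial.induction_on with
  | C a => simpa using hasDerivAt_const y a
  | add p q hp hq => simpa using hp.fun_add hq
  | mul_X p i hp =>
    have hi : HasDerivAt (fun y' : ℝ => (![x, y'] : Fin 2 → ℝ) i)
        (MvPolynomial.eval ![x, y] (MvPolynomial.pderiv 1 (MvPolynomial.X i))) y := by
      fin_cases i
      · simpa [MvPolynomial.pderiv_X] using hasDerivAt_const y x
      · simpa using hasDerivAt_id' y
    simpa [Derivation.leibniz, add_comm, mul_comm] using hi.fun_mul hp

lemma continuous_polyEval (p : MvPolynomial (Fin 2) ℝ) :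
    Continuous (fun z : ℝ × ℝ => polyEval p z.1 z.2) := by
  unfold polyEval
  refine (MvPolynomial.continuous_eval p).comp (continuous_pi fun i => ?_)
  fin_cases i
  · exact continuous_fst
  · exact continuous_snd

lemma pdx_iterate_pdy_iterate_polyEval (i j : ℕ) (p : MvPolynomial (Fin 2) ℝ) :
    pdx^[i] (pdy^[j] (polyEval p)) =
      polyEval ((MvPolynomial.pderiv 0)^[i] ((MvPolynomial.pderiv 1)^[j] p)) := by
  have hx : Function.Semiconj polyEval (MvPolynomial.pderiv 0) pdx := fun q => by
    funext x y
    exact (hasDerivAt_polyEval_fst q x y).deriv.symm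
  have hy : Function.Semiconj polyEval (MvPolynomial.pderiv 1) pdy := fun q => by
    funext x y
    exact (hasDerivAt_polyEval_snd q x y).deriv.symm
  rw [(hx.iterate_right i).eq, (hy.iterate_right j).eq]

lemma pderiv_surjective {σ : Type*} (i : σ) :
    Function.Surjective (MvPolynomial.pderiv i : MvPolynomial σ ℝ → MvPolynomial σ ℝ) := by
  classical
  intro q
  induction q using MvPolynomial.induction_on' with
  | monomial m c =>
    refine ⟨MvPolynomial.monomial (m + Finsupp.single i 1) (c / (m i + 1)), ?_⟩
    have : (m i : ℝ) + 1 ≠ 0 := by positivity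
    simp [MvPolynomial.pderiv_monomial, this]
  | add p q hp hq =>
    obtain ⟨P, rfl⟩ := hp
    obtain ⟨Q, rfl⟩ := hq
    exact ⟨P + Q, map_add _ _ _⟩

lemma derivative_surjective :
    Function.Surjective (Polynomial.derivative : Polynomial ℝ → Polynomial ℝ) := by
  intro q
  induction q using Polynomial.induction_on' with
  | monomial n c =>
    refine ⟨Polynomial.monomial (n + 1) (c / (n + 1)), ?_⟩
    have : (n : ℝ) + 1 ≠ 0 := by positivity
    simp [this]
  | add p q hp hq =>
    obtain ⟨P, rfl⟩ := hp
    obtain ⟨Q, rfl⟩ := hq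
    exact ⟨P + Q, map_add _ _ _⟩

lemma pderiv_aeval_X_self {σ : Type*} (i : σ) (r : Polynomial ℝ) :
    MvPolynomial.pderiv i (Polynomial.aeval (MvPolynomial.X i : MvPolynomial σ ℝ) r) =
      Polynomial.aeval (MvPolynomial.X i) (Polynomial.derivative r) := by
  rw [Derivation.map_aeval]
  simp

lemma pderiv_aeval_X_of_ne {σ : Type*} {i j : σ} (h : j ≠ i) (r : Polynomial ℝ) :
    MvPolynomial.pderiv i (Polynomial.aeval (MvPolynomial.X j : MvPolynomial σ ℝ) r) = 0 := by
  rw [Derivation.map_aeval]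
  simp [MvPolynomial.pderiv_X_of_ne h]

lemma pderiv_iterate_aeval_X_self {σ : Type*} (i : σ) (r : Polynomial ℝ) (n : ℕ) :
    (MvPolynomial.pderiv i)^[n] (Polynomial.aeval (MvPolynomial.X i : MvPolynomial σ ℝ) r) =
      Polynomial.aeval (MvPolynomial.X i) (Polynomial.derivative^[n] r) := by
  have h : Function.Semiconj
      (fun r : Polynomial ℝ => Polynomial.aeval (MvPolynomial.X i : MvPolynomial σ ℝ) r)
      Polynomial.derivative (MvPolynomial.pderiv i) :=
    fun r => (pderiv_aeval_X_self i r).symm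
  exact ((h.iterate_right n).eq r).symm

lemma pderiv_iterate_add {σ : Type*} (i : σ) (n : ℕ) (p q : MvPolynomial σ ℝ) :
    (MvPolynomial.pderiv i)^[n] (p + q) =
      (MvPolynomial.pderiv i)^[n] p + (MvPolynomial.pderiv i)^[n] q :=
  iterate_map_add _ _ _ _

lemma polyEval_add (p q : MvPolynomial (Fin 2) ℝ) (x y : ℝ) :
    polyEval (p + q) x y = polyEval p x y + polyEval q x y := map_add _ _ _

lemma polyEval_aeval_X_zero (r : Polynomial ℝ) (x y : ℝ) :
    polyEval (Polynomial.aeval (MvPolynomial.X 0) r) x y = r.eval x := by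
  induction r using Polynomial.induction_on' with
  | monomial n c => simp [polyEval, Polynomial.aeval_monomial]
  | add p q hp hq => rw [map_add, polyEval_add, hp, hq, Polynomial.eval_add]

lemma polyEval_aeval_X_one (r : Polynomial ℝ) (x y : ℝ) :
    polyEval (Polynomial.aeval (MvPolynomial.X 1) r) x y = r.eval y := by
  induction r using Polynomial.induction_on' with
  | monomial n c => simp [polyEval, Polynomial.aeval_monomial]
  | add p q hp hq => rw [map_add, polyEval_add, hp, hq, Polynomial.eval_add]

lemma pderiv_commute {σ : Type*} (i j : σ) :
    Function.Commute (MvPolynomial.pderiv i : MvPolynomial σ ℝ → MvPolynomial σ ℝ)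
      (MvPolynomial.pderiv j) := by
  classical
  intro p
  have h : ⁅(MvPolynomial.pderiv i : Derivation ℝ (MvPolynomial σ ℝ) (MvPolynomial σ ℝ)),
      (MvPolynomial.pderiv j : Derivation ℝ (MvPolynomial σ ℝ) (MvPolynomial σ ℝ))⁆ = 0 := by
    refine MvPolynomial.derivation_ext fun k => ?_
    simp [Derivation.commutator_apply, MvPolynomial.pderiv_X, Pi.single_apply, apply_ite]
  have := DFunLike.congr_fun h p
  simpa [Derivation.commutator_apply, sub_eq_zero] using this

open Set in
lemma exists_polynomial_near_iterate_derivative {a b : ℝ} (hab : a ≤ b) (n : ℕ) :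
    ∀ (g : ℕ → ℝ → ℝ), ContinuousOn (g n) (Icc a b) →
      (∀ j < n, ∀ x ∈ Icc a b, HasDerivAt (g j) (g (j + 1) x) x) → ∀ δ > 0,
      ∃ r : Polynomial ℝ, ∀ j ≤ n, ∀ x ∈ Icc a b,
        |g j x - (Polynomial.derivative^[j] r).eval x| ≤ δ := by
  induction n with
  | zero =>
    intro g hc _ δ hδ
    obtain ⟨r, hr⟩ := exists_polynomial_near_of_continuousOn a b (g 0) hc δ hδ
    refine ⟨r, fun j hj x hx => ?_⟩
    obtain rfl : j = 0 := by omega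
    rw [abs_sub_comm]
    exact (hr x hx).le
  | succ n ih =>
    intro g hc hd δ hδ
    have hL : 0 < b - a + 1 := by linarith
    obtain ⟨q, hq⟩ := ih (fun j => g (j + 1)) hc (fun j hj => hd (j + 1) (by omega))
      (δ / (b - a + 1)) (by positivity)
    have hη : δ / (b - a + 1) * (b - a) ≤ δ := by
      rw [div_mul_eq_mul_div, div_le_iff₀ hL]
      nlinarith
    have hη' : δ / (b - a + 1) ≤ δ := div_le_self hδ.le (by linarith)
    obtain ⟨Q, rfl⟩ := derivative_surjective q
    have hdQ : Polynomial.derivative (Q + Polynomial.C (g 0 a - Q.eval a)) =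
        Polynomial.derivative Q := by simp
    refine ⟨Q + Polynomial.C (g 0 a - Q.eval a), fun j hj x hx => ?_⟩
    cases j with
    | zero =>
      have := abs_le_of_hasDerivAt (θ := 0)
        (fun x hx => (hd 0 (by omega) x hx).sub
          ((Q + Polynomial.C (g 0 a - Q.eval a)).hasDerivAt x))
        (fun x hx => by rw [hdQ]; exact hq 0 (by omega) x hx) (by simp) x hx
      simp only [Pi.sub_apply] at this
      simp only [Function.iterate_zero, id]
      linarith
    | succ j =>
      rw [Function.iterate_succ_apply, hdQ]
      exact (hq j (by omega) x hx).trans hη'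

open Set in
lemma exists_mvPolynomial_near {a b : ℝ} (f : ℝ → ℝ → ℝ)
    (hf : ContinuousOn (fun z : ℝ × ℝ => f z.1 z.2) (Icc a b ×ˢ Icc a b)) {δ : ℝ} (hδ : 0 < δ) :
    ∃ p : MvPolynomial (Fin 2) ℝ, ∀ x ∈ Icc a b, ∀ y ∈ Icc a b, |f x y - polyEval p x y| ≤ δ := by
  let X := (Icc a b ×ˢ Icc a b : Set (ℝ × ℝ))
  have : CompactSpace X := isCompact_iff_compactSpace.mp (isCompact_Icc.prod isCompact_Icc)
  let c : Fin 2 → C(X, ℝ) :=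
    ![⟨fun z => z.1.1, by fun_prop⟩, ⟨fun z => z.1.2, by fun_prop⟩]
  have hc : ∀ (p : MvPolynomial (Fin 2) ℝ) (z : X),
      (MvPolynomial.aeval c p) z = polyEval p z.1.1 z.1.2 := by
    intro p z
    unfold polyEval
    induction p using MvPolynomial.induction_on with
    | C r => simp
    | add p q hp hq => simp [hp, hq]
    | mul_X p i hp =>
      rw [map_mul, ContinuousMap.mul_apply, hp]
      fin_cases i <;> simp [c]
  obtain ⟨⟨g, hg⟩, hgf⟩ :=
    ContinuousMap.exists_mem_subalgebra_near_continuous_of_separatesPoints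
      (MvPolynomial.aeval (R := ℝ) c).range
      (by
        intro z w hzw
        by_cases h : z.1.1 = w.1.1
        · refine ⟨c 1, ⟨c 1, ⟨MvPolynomial.X 1, by simp⟩, rfl⟩, fun h' => hzw ?_⟩
          exact Subtype.ext (Prod.ext h h')
        · exact ⟨c 0, ⟨c 0, ⟨MvPolynomial.X 0, by simp⟩, rfl⟩, h⟩)
      _ (continuousOn_iff_continuous_domRestrict.mp hf) δ hδ
  obtain ⟨p, rfl⟩ := hg
  refine ⟨p, fun x hx y hy => ?_⟩
  have h := hgf ⟨(x, y), hx, hy⟩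
  rw [abs_sub_comm]
  have h2 := hc p ⟨(x, y), hx, hy⟩
  simp only [Real.norm_eq_abs, domRestrict_apply] at h h2
  rw [← h2]
  exact h.le

open Set in
lemma exists_mvPolynomial_near_iterate_pderiv_snd {a b : ℝ} (hab : a ≤ b) (l : ℕ) :
    ∀ (g : ℕ → ℝ → ℝ → ℝ),
      (∀ j ≤ l, ContinuousOn (fun z : ℝ × ℝ => g j z.1 z.2) (Icc a b ×ˢ Icc a b)) →
      (∀ j < l, ∀ x ∈ Icc a b, ∀ y ∈ Icc a b, HasDerivAt (g j x) (g (j + 1) x y) y) →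
      ∀ δ > 0, ∃ p : MvPolynomial (Fin 2) ℝ, ∀ j ≤ l, ∀ x ∈ Icc a b, ∀ y ∈ Icc a b,
        |g j x y - polyEval ((MvPolynomial.pderiv 1)^[j] p) x y| ≤ δ := by
  induction l with
  | zero =>
    intro g hc _ δ hδ
    obtain ⟨p, hp⟩ := exists_mvPolynomial_near (g 0) (hc 0 le_rfl) hδ
    refine ⟨p, fun j hj => ?_⟩
    obtain rfl : j = 0 := by omega
    exact hp
  | succ l ih =>
    intro g hc hd δ hδ
    have hL : 0 < b - a + 1 := by linarith
    obtain ⟨q, hq⟩ := ih (fun j => g (j + 1)) (fun j hj => hc (j + 1) (by omega))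
      (fun j hj => hd (j + 1) (by omega)) (δ / 2 / (b - a + 1)) (by positivity)
    have hη : δ / 2 / (b - a + 1) * (b - a) ≤ δ / 2 := by
      rw [div_mul_eq_mul_div, div_le_iff₀ hL]
      nlinarith
    have hη' : δ / 2 / (b - a + 1) ≤ δ :=
      (div_le_self (by positivity) (by linarith)).trans (by linarith)
    obtain ⟨Q, rfl⟩ := pderiv_surjective 1 q
    have haI : a ∈ Icc a b := left_mem_Icc.mpr hab
    have hcont : ContinuousOn (fun x => g 0 x a - polyEval Q x a) (Icc a b) := by
      refine ContinuousOn.sub ?_ ?_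
      · exact (hc 0 (by omega)).comp (f := fun x : ℝ => (x, a)) (by fun_prop)
          fun x hx => ⟨hx, haI⟩
      · exact ((continuous_polyEval Q).comp (f := fun x : ℝ => (x, a)) (by fun_prop)).continuousOn
    obtain ⟨r, hr⟩ := exists_polynomial_near_of_continuousOn a b _ hcont (δ / 2) (by positivity)
    set R : MvPolynomial (Fin 2) ℝ := Polynomial.aeval (MvPolynomial.X 0) r with hR
    have hdR : MvPolynomial.pderiv 1 (Q + R) = MvPolynomial.pderiv 1 Q := by
      rw [map_add, hR, pderiv_aeval_X_of_ne (by decide), add_zero]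
    refine ⟨Q + R, fun j hj x hx y hy => ?_⟩
    cases j with
    | zero =>
      have hbd : |g 0 x a - polyEval (Q + R) x a| ≤ δ / 2 := by
        rw [polyEval_add, hR, polyEval_aeval_X_zero, abs_sub_comm]
        refine le_trans (le_of_eq ?_) (hr x hx).le
        congr 1
        ring
      have := abs_le_of_hasDerivAt (θ := δ / 2)
        (fun y hy => (hd 0 (by omega) x hx y hy).fun_sub (hasDerivAt_polyEval_snd (Q + R) x y))
        (fun y hy => by rw [hdR]; exact hq 0 (by omega) x hx y hy) hbd y hy
      simp only [Function.iterate_zero, id]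
      linarith
    | succ j =>
      rw [Function.iterate_succ_apply, hdR]
      exact (hq j (by omega) x hx y hy).trans hη'

open Set in
/-- A function whose mixed partial derivatives `f i j`, `i ≤ k`, `j ≤ l`, are continuous on a
square is approximated by a polynomial uniformly together with all these derivatives. -/
theorem exists_mvPolynomial_near_iterate_pderiv {a b : ℝ} (hab : a ≤ b) (k l : ℕ) :
    ∀ (f : ℕ → ℕ → ℝ → ℝ → ℝ),
      (∀ i ≤ k, ∀ j ≤ l,
        ContinuousOn (fun z : ℝ × ℝ => f i j z.1 z.2) (Icc a b ×ˢ Icc a b)) →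
      (∀ i < k, ∀ j ≤ l, ∀ x ∈ Icc a b, ∀ y ∈ Icc a b,
        HasDerivAt (fun x' => f i j x' y) (f (i + 1) j x y) x) →
      (∀ i ≤ k, ∀ j < l, ∀ x ∈ Icc a b, ∀ y ∈ Icc a b,
        HasDerivAt (f i j x) (f i (j + 1) x y) y) →
      ∀ δ > 0, ∃ p : MvPolynomial (Fin 2) ℝ,
        ∀ i ≤ k, ∀ j ≤ l, ∀ x ∈ Icc a b, ∀ y ∈ Icc a b,
          |f i j x y -
            polyEval ((MvPolynomial.pderiv 0)^[i] ((MvPolynomial.pderiv 1)^[j] p)) x y| ≤ δ := by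
  induction k with
  | zero =>
    intro f hc _ hy δ hδ
    obtain ⟨p, hp⟩ := exists_mvPolynomial_near_iterate_pderiv_snd hab l (f 0) (hc 0 le_rfl)
      (hy 0 le_rfl) δ hδ
    refine ⟨p, fun i hi => ?_⟩
    obtain rfl : i = 0 := by omega
    exact hp
  | succ k ih =>
    intro f hc hx hy δ hδ
    have hL : 0 < b - a + 1 := by linarith
    obtain ⟨q, hq⟩ := ih (fun i => f (i + 1)) (fun i hi => hc (i + 1) (by omega))
      (fun i hi => hx (i + 1) (by omega)) (fun i hi => hy (i + 1) (by omega))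
      (δ / 2 / (b - a + 1)) (by positivity)
    have hη : δ / 2 / (b - a + 1) * (b - a) ≤ δ / 2 := by
      rw [div_mul_eq_mul_div, div_le_iff₀ hL]
      nlinarith
    have hη' : δ / 2 / (b - a + 1) ≤ δ :=
      (div_le_self (by positivity) (by linarith)).trans (by linarith)
    obtain ⟨Q, rfl⟩ := pderiv_surjective 0 q
    have haI : a ∈ Icc a b := left_mem_Icc.mpr hab
    obtain ⟨r, hr⟩ := exists_polynomial_near_iterate_derivative hab l
      (fun j y => f 0 j a y - polyEval ((MvPolynomial.pderiv 1)^[j] Q) a y)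
      (by
        refine ContinuousOn.sub ?_ ?_
        · exact (hc 0 (by omega) l le_rfl).comp (f := fun y : ℝ => (a, y)) (by fun_prop)
            fun y hy => ⟨haI, hy⟩
        · exact ((continuous_polyEval _).comp
            (f := fun y : ℝ => (a, y)) (by fun_prop)).continuousOn)
      (fun j hj y hyI => by
        rw [Function.iterate_succ_apply']
        exact (hy 0 (by omega) j hj a haI y hyI).fun_sub (hasDerivAt_polyEval_snd _ a y))
      (δ / 2) (by positivity)
    set R : MvPolynomial (Fin 2) ℝ := Polynomial.aeval (MvPolynomial.X 1) r with hR
    have hdR : ∀ j, MvPolynomial.pderiv 0 ((MvPolynomial.pderiv 1)^[j] (Q + R)) =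
        (MvPolynomial.pderiv 1)^[j] (MvPolynomial.pderiv 0 Q) := fun j => by
      rw [((pderiv_commute 0 1).iterate_right j).eq, map_add, hR,
        pderiv_aeval_X_of_ne (by decide), add_zero]
    refine ⟨Q + R, fun i hi j hj x hxI y hyI => ?_⟩
    cases i with
    | zero =>
      have hbd : |f 0 j a y - polyEval ((MvPolynomial.pderiv 1)^[j] (Q + R)) a y| ≤ δ / 2 := by
        rw [pderiv_iterate_add, polyEval_add, hR, pderiv_iterate_aeval_X_self,
          polyEval_aeval_X_one, ← sub_sub]
        exact hr j hj y hyI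
      have := abs_le_of_hasDerivAt (θ := δ / 2)
        (fun x hxI => (hx 0 (by omega) j hj x hxI y hyI).fun_sub
          (hasDerivAt_polyEval_fst ((MvPolynomial.pderiv 1)^[j] (Q + R)) x y))
        (fun x hxI => by rw [hdR]; exact hq 0 (by omega) j hj x hxI y hyI) hbd x hxI
      simp only [Function.iterate_zero, id]
      linarith
    | succ i =>
      rw [Function.iterate_succ_apply, hdR]
      exact (hq i (by omega) j hj x hxI y hyI).trans hη'

/-! ### The normal distribution function and its inverse -/

/-- The standard normal density. -/
def phi (t : ℝ) : ℝ := Real.exp (-t ^ 2 / 2) / Real.sqrt (2 * Real.pi)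

lemma phi_pos (t : ℝ) : 0 < phi t := by
  unfold phi
  positivity

lemma continuous_phi : Continuous phi := by
  unfold phi
  fun_prop

lemma phi_eq_gaussianPDFReal : phi = ProbabilityTheory.gaussianPDFReal 0 1 := by
  funext t
  simp [phi, ProbabilityTheory.gaussianPDFReal, div_eq_mul_inv, mul_comm]

lemma integrable_phi : Integrable phi := by
  rw [phi_eq_gaussianPDFReal]
  exact ProbabilityTheory.integrable_gaussianPDFReal 0 1

lemma integral_phi : ∫ t, phi t = 1 := by
  rw [phi_eq_gaussianPDFReal]
  exact ProbabilityTheory.integral_gaussianPDFReal_eq_one 0 one_ne_zero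

lemma hasDerivAt_phi (t : ℝ) : HasDerivAt phi (-t * phi t) t := by
  unfold phi
  have h : HasDerivAt (fun t : ℝ => -t ^ 2 / 2) (-t) t := by
    refine (((hasDerivAt_pow 2 t).fun_neg).div_const 2).congr_deriv ?_
    simp
    ring
  refine (h.exp.div_const (Real.sqrt (2 * Real.pi))).congr_deriv ?_
  ring

lemma hasStrictDerivAt_integral_Iic {f : ℝ → ℝ} (hf : Continuous f) (hi : Integrable f) (t : ℝ) :
    HasStrictDerivAt (fun t => ∫ s in Set.Iic t, f s) (f t) t := by
  have h : (fun t => ∫ s in Set.Iic t, f s) =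
      fun t => (∫ s in (0 : ℝ)..t, f s) + ∫ s in Set.Iic 0, f s := by
    funext t
    rw [← intervalIntegral.integral_Iic_sub_Iic hi.integrableOn hi.integrableOn]
    ring
  rw [h]
  exact (hf.integral_hasStrictDerivAt 0 t).add_const _

lemma Phi_eq (t : ℝ) : Phi t = ∫ s in Set.Iic t, phi s := rfl

lemma hasStrictDerivAt_Phi (t : ℝ) : HasStrictDerivAt Phi (phi t) t :=
  hasStrictDerivAt_integral_Iic continuous_phi integrable_phi t

lemma continuous_Phi : Continuous Phi :=
  continuous_iff_continuousAt.mpr fun t => (hasStrictDerivAt_Phi t).hasDerivAt.continuousAt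

lemma Phi_nonneg (t : ℝ) : 0 ≤ Phi t :=
  integral_nonneg fun s => (phi_pos s).le

lemma Phi_le_one (t : ℝ) : Phi t ≤ 1 := by
  rw [Phi_eq, ← integral_phi]
  exact setIntegral_le_integral integrable_phi (Filter.Eventually.of_forall fun s => (phi_pos s).le)

lemma Phi_strictMono : StrictMono Phi :=
  strictMono_of_hasDerivAt_pos (fun t => (hasStrictDerivAt_Phi t).hasDerivAt) phi_pos

lemma tendsto_Phi_atTop : Filter.Tendsto Phi Filter.atTop (nhds 1) := by
  rw [← integral_phi]
  exact (aecover_Iic Filter.tendsto_id).integral_tendsto_of_countably_generated integrable_phi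

lemma tendsto_Phi_atBot : Filter.Tendsto Phi Filter.atBot (nhds 0) := by
  have h : Phi = fun t => (∫ s in Set.Iic (0 : ℝ), phi s) - ∫ s in t..0, phi s := by
    funext t
    rw [← intervalIntegral.integral_Iic_sub_Iic integrable_phi.integrableOn
      integrable_phi.integrableOn, Phi_eq]
    ring
  rw [h]
  have := (tendsto_const_nhds (x := ∫ s in Set.Iic (0 : ℝ), phi s)).sub
    (intervalIntegral_tendsto_integral_Iic 0 integrable_phi.integrableOn Filter.tendsto_id)
  simpa using this

lemma PhiInv_Phi (t : ℝ) : PhiInv (Phi t) = t :=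
  Function.leftInverse_invFun Phi_strictMono.injective t

lemma Phi_PhiInv {x : ℝ} (hx : x ∈ Set.Ioo (0 : ℝ) 1) : Phi (PhiInv x) = x := by
  obtain ⟨s, hs⟩ := (tendsto_Phi_atBot.eventually_lt_const hx.1).exists
  obtain ⟨t, ht⟩ := (tendsto_Phi_atTop.eventually_const_lt hx.2).exists
  obtain ⟨u, rfl⟩ := mem_range_of_exists_le_of_exists_ge continuous_Phi ⟨s, hs.le⟩ ⟨t, ht.le⟩
  rw [PhiInv_Phi]

lemma hasDerivAt_PhiInv {x : ℝ} (hx : x ∈ Set.Ioo (0 : ℝ) 1) :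
    HasDerivAt PhiInv (phi (PhiInv x))⁻¹ x := by
  have h := (hasStrictDerivAt_Phi (PhiInv x)).to_local_left_inverse (phi_pos _).ne'
    (Filter.Eventually.of_forall PhiInv_Phi)
  rw [Phi_PhiInv hx] at h
  exact h.hasDerivAt

/-! ### The bivariate normal distribution function -/

/-- The density of a centered bivariate Gaussian with unit variances and covariance `ρ`. -/
def bivariateDensity (ρ s t : ℝ) : ℝ :=
  Real.exp (-(s ^ 2 - 2 * ρ * s * t + t ^ 2) / (2 * (1 - ρ ^ 2))) /
    (2 * Real.pi * Real.sqrt (1 - ρ ^ 2))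

/-- The ratio of the bivariate Gaussian density and the product of its marginals. -/
def densityRatio (ρ u v : ℝ) : ℝ :=
  Real.exp (-(ρ ^ 2 * u ^ 2 - 2 * ρ * u * v + ρ ^ 2 * v ^ 2) / (2 * (1 - ρ ^ 2))) /
    Real.sqrt (1 - ρ ^ 2)

/-- The bivariate normal distribution function. -/
def bivariateCDF (ρ u v : ℝ) : ℝ := ∫ s in Set.Iic u, ∫ t in Set.Iic v, bivariateDensity ρ s t

lemma one_sub_sq_pos {ρ : ℝ} (hρ : ρ ∈ Set.Ioo (-1 : ℝ) 1) : 0 < 1 - ρ ^ 2 := by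
  nlinarith [hρ.1, hρ.2]

lemma bivariateDensity_swap (ρ s t : ℝ) : bivariateDensity ρ s t = bivariateDensity ρ t s := by
  unfold bivariateDensity
  congr 3
  ring

lemma densityRatio_swap (ρ u v : ℝ) : densityRatio ρ u v = densityRatio ρ v u := by
  unfold densityRatio
  congr 3
  ring

lemma phi_conditional {ρ : ℝ} (hρ : ρ ∈ Set.Ioo (-1 : ℝ) 1) (u v : ℝ) :
    phi ((v - ρ * u) / Real.sqrt (1 - ρ ^ 2)) / Real.sqrt (1 - ρ ^ 2) =
      densityRatio ρ u v * phi v := by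
  have h := one_sub_sq_pos hρ
  unfold phi densityRatio
  rw [div_pow, Real.sq_sqrt h.le, div_mul_div_comm, ← Real.exp_add, div_div,
    mul_comm (Real.sqrt (2 * Real.pi))]
  congr 2
  field_simp
  ring

lemma bivariateDensity_eq {ρ : ℝ} (hρ : ρ ∈ Set.Ioo (-1 : ℝ) 1) (s t : ℝ) :
    bivariateDensity ρ s t =
      phi s * (phi ((t - ρ * s) / Real.sqrt (1 - ρ ^ 2)) / Real.sqrt (1 - ρ ^ 2)) := by
  have h := one_sub_sq_pos hρ
  rw [phi_conditional hρ]
  unfold bivariateDensity densityRatio phi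
  have h2 : Real.sqrt (2 * Real.pi) * Real.sqrt (2 * Real.pi) = 2 * Real.pi :=
    Real.mul_self_sqrt (by positivity)
  rw [div_mul_div_comm, div_mul_div_comm, ← Real.exp_add, ← Real.exp_add]
  congr 1
  · congr 1
    field_simp
    ring
  · linear_combination (-Real.sqrt (1 - ρ ^ 2)) * h2

lemma integral_Iic_phi_affine {σ : ℝ} (hσ : 0 < σ) (m v : ℝ) :
    ∫ t in Set.Iic v, phi ((t - m) / σ) / σ = Phi ((v - m) / σ) := by
  have himage : (fun t => (t - m) / σ) '' Set.Iic v = Set.Iic ((v - m) / σ) := by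
    ext z
    constructor
    · rintro ⟨t, ht, rfl⟩
      have : t ≤ v := ht
      show (t - m) / σ ≤ (v - m) / σ
      gcongr
    · intro hz
      refine ⟨σ * z + m, ?_, ?_⟩
      · have : z ≤ (v - m) / σ := hz
        rw [le_div_iff₀ hσ] at this
        show σ * z + m ≤ v
        linarith
      · field_simp
        ring
  rw [Phi_eq, ← himage, integral_image_eq_integral_abs_deriv_smul
    (f := fun t => (t - m) / σ) (f' := fun _ => 1 / σ)
    measurableSet_Iic
    (fun t _ => (((hasDerivAt_id t).sub_const m).div_const σ).hasDerivWithinAt)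
    (fun t _ t' _ h => by simpa [hσ.ne'] using h)]
  refine integral_congr_ae (Filter.Eventually.of_forall fun t => ?_)
  simp [abs_of_pos hσ, div_eq_inv_mul]

lemma bivariateCDF_eq {ρ : ℝ} (hρ : ρ ∈ Set.Ioo (-1 : ℝ) 1) (u v : ℝ) :
    bivariateCDF ρ u v =
      ∫ s in Set.Iic u, phi s * Phi ((v - ρ * s) / Real.sqrt (1 - ρ ^ 2)) := by
  unfold bivariateCDF
  simp_rw [bivariateDensity_eq hρ, integral_const_mul,
    integral_Iic_phi_affine (Real.sqrt_pos.mpr (one_sub_sq_pos hρ))]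

lemma integrable_bivariateDensity {ρ : ℝ} (hρ : ρ ∈ Set.Ioo (-1 : ℝ) 1) :
    Integrable (fun z : ℝ × ℝ => bivariateDensity ρ z.1 z.2) := by
  have h := one_sub_sq_pos hρ
  have hρ' : 0 < 1 - |ρ| := sub_pos.mpr (abs_lt.mpr hρ)
  set c := (1 - |ρ|) / (2 * (1 - ρ ^ 2)) with hc
  have hc0 : 0 < c := by positivity
  have hint := ((integrable_exp_neg_mul_sq hc0).mul_prod (integrable_exp_neg_mul_sq hc0)).div_const
    (2 * Real.pi * Real.sqrt (1 - ρ ^ 2))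
  refine hint.mono' ?_ (Filter.Eventually.of_forall fun z => ?_)
  · unfold bivariateDensity
    exact Continuous.aestronglyMeasurable (by fun_prop)
  · unfold bivariateDensity
    rw [Real.norm_of_nonneg (by positivity), ← Real.exp_add]
    gcongr
    have hst : ρ * (2 * z.1 * z.2) ≤ |ρ| * (z.1 ^ 2 + z.2 ^ 2) := by
      refine (le_abs_self _).trans ?_
      rw [abs_mul]
      gcongr
      rw [abs_le]
      constructor <;> nlinarith [sq_nonneg (z.1 + z.2), sq_nonneg (z.1 - z.2)]
    have hrhs : -c * z.1 ^ 2 + -c * z.2 ^ 2 =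
        (-((1 - |ρ|) * (z.1 ^ 2 + z.2 ^ 2))) / (2 * (1 - ρ ^ 2)) := by
      rw [hc]
      ring
    rw [hrhs]
    gcongr
    linarith

lemma bivariateCDF_swap {ρ : ℝ} (hρ : ρ ∈ Set.Ioo (-1 : ℝ) 1) (u v : ℝ) :
    bivariateCDF ρ u v = bivariateCDF ρ v u := by
  unfold bivariateCDF
  rw [integral_integral_swap]
  · simp_rw [fun s t => bivariateDensity_swap ρ t s]
  · rw [Measure.prod_restrict]
    exact (integrable_bivariateDensity hρ).integrableOn

lemma hasDerivAt_bivariateCDF_fst {ρ : ℝ} (hρ : ρ ∈ Set.Ioo (-1 : ℝ) 1) (u v : ℝ) :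
    HasDerivAt (fun u => bivariateCDF ρ u v)
      (phi u * Phi ((v - ρ * u) / Real.sqrt (1 - ρ ^ 2))) u := by
  simp_rw [bivariateCDF_eq hρ]
  have hcont : Continuous fun s => phi s * Phi ((v - ρ * s) / Real.sqrt (1 - ρ ^ 2)) :=
    continuous_phi.mul (continuous_Phi.comp (by fun_prop))
  refine (hasStrictDerivAt_integral_Iic hcont ?_ u).hasDerivAt
  refine integrable_phi.mono' hcont.aestronglyMeasurable (Filter.Eventually.of_forall fun s => ?_)
  rw [Real.norm_of_nonneg (mul_nonneg (phi_pos s).le (Phi_nonneg _))]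
  exact mul_le_of_le_one_right (phi_pos s).le (Phi_le_one _)

lemma continuousAt_bivariateCDF {ρ : ℝ} (hρ : ρ ∈ Set.Ioo (-1 : ℝ) 1) (u v : ℝ) :
    ContinuousAt (fun z : ℝ × ℝ × ℝ => bivariateCDF z.1 z.2.1 z.2.2) (ρ, u, v) := by
  have hev : ∀ᶠ z : ℝ × ℝ × ℝ in nhds (ρ, u, v), z.1 ∈ Set.Ioo (-1 : ℝ) 1 :=
    continuousAt_fst.eventually (Ioo_mem_nhds hρ.1 hρ.2)
  have heq : (fun z : ℝ × ℝ × ℝ => bivariateCDF z.1 z.2.1 z.2.2) =ᶠ[nhds (ρ, u, v)]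
      fun z => ∫ s, (Set.Iic z.2.1).indicator
        (fun s => phi s * Phi ((z.2.2 - z.1 * s) / Real.sqrt (1 - z.1 ^ 2))) s := by
    filter_upwards [hev] with z hz
    rw [bivariateCDF_eq hz, integral_indicator measurableSet_Iic]
  refine ContinuousAt.congr ?_ heq.symm
  refine continuousAt_of_dominated (bound := phi) (Filter.Eventually.of_forall fun z => ?_)
    (Filter.Eventually.of_forall fun z => Filter.Eventually.of_forall fun s => ?_)
    integrable_phi ?_
  · refine AEStronglyMeasurable.indicator (Continuous.aestronglyMeasurable ?_) measurableSet_Iic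
    exact continuous_phi.mul (continuous_Phi.comp (by fun_prop))
  · refine (norm_indicator_le_norm_self _ _).trans ?_
    rw [Real.norm_of_nonneg (mul_nonneg (phi_pos s).le (Phi_nonneg _))]
    exact mul_le_of_le_one_right (phi_pos s).le (Phi_le_one _)
  · have hne : ∀ᵐ s : ℝ, s ≠ u := Measure.ae_ne volume u
    filter_upwards [hne] with s hs
    have hc : ContinuousAt (fun z : ℝ × ℝ × ℝ =>
        phi s * Phi ((z.2.2 - z.1 * s) / Real.sqrt (1 - z.1 ^ 2))) (ρ, u, v) := by
      refine continuousAt_const.mul (continuous_Phi.continuousAt.comp ?_)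
      refine ContinuousAt.div (by fun_prop) (by fun_prop) ?_
      exact (Real.sqrt_pos.mpr (one_sub_sq_pos hρ)).ne'
    have hu : ContinuousAt (fun z : ℝ × ℝ × ℝ => z.2.1) (ρ, u, v) := by fun_prop
    rcases lt_or_gt_of_ne hs with h | h
    · refine hc.congr ?_
      filter_upwards [hu.eventually (lt_mem_nhds h)] with z hz
      rw [Set.indicator_of_mem (show s ∈ Set.Iic z.2.1 from le_of_lt hz)]
    · refine (continuousAt_const (y := (0 : ℝ))).congr ?_
      filter_upwards [hu.eventually (gt_mem_nhds h)] with z hz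
      rw [Set.indicator_of_notMem (show s ∉ Set.Iic z.2.1 from not_le.mpr hz)]

lemma J_eq_bivariateCDF (ρ : ℝ) {x y : ℝ} (hx : x ∈ Set.Ioo (0 : ℝ) 1)
    (hy : y ∈ Set.Ioo (0 : ℝ) 1) : J ρ x y = bivariateCDF ρ (PhiInv x) (PhiInv y) := by
  unfold J
  rw [if_neg (not_or.mpr ⟨hx.1.ne', hy.1.ne'⟩), if_neg hx.2.ne, if_neg hy.2.ne]
  rfl

/-! ### The mixed partial derivatives of `J` -/

/-- The mixed partial derivative `∂ⁱ⁺ʲJ_ρ/∂xⁱ∂yʲ`, `i, j ≤ 2`, at `(Φ(u), Φ(v))`. -/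
def jet (ρ : ℝ) : ℕ → ℕ → ℝ → ℝ → ℝ
  | 0, 0 => fun u v => bivariateCDF ρ u v
  | 1, 0 => fun u v => Phi ((v - ρ * u) / Real.sqrt (1 - ρ ^ 2))
  | 0, 1 => fun u v => Phi ((u - ρ * v) / Real.sqrt (1 - ρ ^ 2))
  | 1, 1 => fun u v => densityRatio ρ u v
  | 2, 0 => fun u v => -ρ * densityRatio ρ u v * phi v / phi u
  | 0, 2 => fun u v => -ρ * densityRatio ρ v u * phi u / phi v
  | 2, 1 => fun u v => densityRatio ρ u v * ((ρ * v - ρ ^ 2 * u) / (1 - ρ ^ 2)) / phi u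
  | 1, 2 => fun u v => densityRatio ρ v u * ((ρ * u - ρ ^ 2 * v) / (1 - ρ ^ 2)) / phi v
  | 2, 2 => fun u v => densityRatio ρ u v / (phi u * phi v) *
      ((ρ * v - ρ ^ 2 * u) * (ρ * u - ρ ^ 2 * v) / (1 - ρ ^ 2) ^ 2 + ρ / (1 - ρ ^ 2))
  | _, _ => 0

lemma jet_swap {ρ : ℝ} (hρ : ρ ∈ Set.Ioo (-1 : ℝ) 1) {i j : ℕ} (hi : i ≤ 2) (hj : j ≤ 2)
    (u v : ℝ) : jet ρ i j u v = jet ρ j i v u := by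
  interval_cases i <;> interval_cases j <;> try rfl
  · exact bivariateCDF_swap hρ u v
  · exact densityRatio_swap ρ u v
  · simp only [jet]
    rw [densityRatio_swap]
    ring

lemma hasDerivAt_densityRatio_fst (ρ u v : ℝ) :
    HasDerivAt (fun u => densityRatio ρ u v)
      (densityRatio ρ u v * ((ρ * v - ρ ^ 2 * u) / (1 - ρ ^ 2))) u := by
  unfold densityRatio
  have h : HasDerivAt
      (fun u : ℝ => -(ρ ^ 2 * u ^ 2 - 2 * ρ * u * v + ρ ^ 2 * v ^ 2) / (2 * (1 - ρ ^ 2)))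
      ((ρ * v - ρ ^ 2 * u) / (1 - ρ ^ 2)) u := by
    have h1 := ((hasDerivAt_pow 2 u).const_mul (ρ ^ 2)).fun_sub
      (((hasDerivAt_id' u).const_mul (2 * ρ)).mul_const v)
    refine ((h1.add_const (ρ ^ 2 * v ^ 2)).fun_neg.div_const (2 * (1 - ρ ^ 2))).congr_deriv ?_
    rw [← mul_div_mul_left (ρ * v - ρ ^ 2 * u) _ (two_ne_zero (α := ℝ))]
    congr 1
    push_cast
    ring
  refine (h.exp.div_const _).congr_deriv ?_
  ring

lemma hasDerivAt_Phi_conditional {ρ : ℝ} (hρ : ρ ∈ Set.Ioo (-1 : ℝ) 1) (u v : ℝ) :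
    HasDerivAt (fun u => Phi ((u - ρ * v) / Real.sqrt (1 - ρ ^ 2)))
      (densityRatio ρ u v * phi u) u := by
  have h1 := ((hasDerivAt_id' u).sub_const (ρ * v)).div_const (Real.sqrt (1 - ρ ^ 2))
  refine (((hasStrictDerivAt_Phi _).hasDerivAt.comp u h1)).congr_deriv ?_
  rw [densityRatio_swap, ← phi_conditional hρ]
  ring

lemma hasDerivAt_Phi_conditional' {ρ : ℝ} (hρ : ρ ∈ Set.Ioo (-1 : ℝ) 1) (u v : ℝ) :
    HasDerivAt (fun u => Phi ((v - ρ * u) / Real.sqrt (1 - ρ ^ 2)))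
      (-ρ * densityRatio ρ u v * phi v) u := by
  have h1 := (((hasDerivAt_id' u).const_mul ρ).const_sub v).div_const (Real.sqrt (1 - ρ ^ 2))
  refine (((hasStrictDerivAt_Phi _).hasDerivAt.comp u h1)).congr_deriv ?_
  rw [mul_assoc, ← phi_conditional hρ]
  ring

lemma hasDerivAt_jet_fst {ρ : ℝ} (hρ : ρ ∈ Set.Ioo (-1 : ℝ) 1) {i j : ℕ} (hi : i < 2)
    (hj : j ≤ 2) (u v : ℝ) :
    HasDerivAt (fun u => jet ρ i j u v) (jet ρ (i + 1) j u v * phi u) u := by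
  have hu := (phi_pos u).ne'
  have hv := (phi_pos v).ne'
  have h := (one_sub_sq_pos hρ).ne'
  interval_cases i <;> interval_cases j <;> simp only [jet]
  · exact (hasDerivAt_bivariateCDF_fst hρ u v).congr_deriv (mul_comm _ _)
  · exact hasDerivAt_Phi_conditional hρ u v
  · simp only [densityRatio_swap ρ v]
    refine ((((hasDerivAt_densityRatio_fst ρ u v).const_mul (-ρ)).fun_mul
      (hasDerivAt_phi u)).div_const (phi v)).congr_deriv ?_
    field_simp
    ring
  · refine (hasDerivAt_Phi_conditional' hρ u v).congr_deriv ?_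
    field_simp
  · refine (hasDerivAt_densityRatio_fst ρ u v).congr_deriv ?_
    field_simp
  · simp only [densityRatio_swap ρ v]
    refine (((hasDerivAt_densityRatio_fst ρ u v).fun_mul
      ((((hasDerivAt_id' u).const_mul ρ).sub_const (ρ ^ 2 * v)).div_const
        (1 - ρ ^ 2))).div_const (phi v)).congr_deriv ?_
    field_simp

lemma continuousAt_densityRatio {ρ : ℝ} (hρ : ρ ∈ Set.Ioo (-1 : ℝ) 1) (u v : ℝ) :
    ContinuousAt (fun z : ℝ × ℝ × ℝ => densityRatio z.1 z.2.1 z.2.2) (ρ, u, v) := by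
  have h := one_sub_sq_pos hρ
  have h' := (Real.sqrt_pos.mpr h).ne'
  unfold densityRatio
  refine ContinuousAt.div (ContinuousAt.rexp (ContinuousAt.div (by fun_prop) (by fun_prop) ?_))
    (by fun_prop) h'
  exact mul_ne_zero two_ne_zero h.ne'

lemma continuousAt_jet {ρ : ℝ} (hρ : ρ ∈ Set.Ioo (-1 : ℝ) 1) {i j : ℕ} (hi : i ≤ 2) (hj : j ≤ 2)
    (u v : ℝ) : ContinuousAt (fun z : ℝ × ℝ × ℝ => jet z.1 i j z.2.1 z.2.2) (ρ, u, v) := by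
  have h := one_sub_sq_pos hρ
  have h' := (Real.sqrt_pos.mpr h).ne'
  have hphi := continuous_phi
  have hPhi := continuous_Phi
  have hr := continuousAt_densityRatio hρ u v
  have hr' : ContinuousAt (fun z : ℝ × ℝ × ℝ => densityRatio z.1 z.2.2 z.2.1) (ρ, u, v) := by
    simpa only [densityRatio_swap] using hr
  interval_cases i <;> interval_cases j <;> simp only [jet]
  · exact continuousAt_bivariateCDF hρ u v
  all_goals
    fun_prop (disch := first
      | exact h'
      | exact h.ne'
      | exact pow_ne_zero 2 h.ne'
      | exact (phi_pos _).ne'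
      | exact mul_ne_zero (phi_pos _).ne' (phi_pos _).ne')

/-- The mixed partial derivative `∂ⁱ⁺ʲJ_ρ/∂xⁱ∂yʲ`, `i, j ≤ 2`, on the open unit square. -/
def partialJ (ρ : ℝ) (i j : ℕ) (x y : ℝ) : ℝ := jet ρ i j (PhiInv x) (PhiInv y)

lemma hasDerivAt_partialJ_fst {ρ : ℝ} (hρ : ρ ∈ Set.Ioo (-1 : ℝ) 1) {i j : ℕ} (hi : i < 2)
    (hj : j ≤ 2) {x : ℝ} (hx : x ∈ Set.Ioo (0 : ℝ) 1) (y : ℝ) :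
    HasDerivAt (fun x' => partialJ ρ i j x' y) (partialJ ρ (i + 1) j x y) x := by
  refine ((hasDerivAt_jet_fst hρ hi hj (PhiInv x) (PhiInv y)).comp x
    (hasDerivAt_PhiInv hx)).congr_deriv ?_
  exact mul_inv_cancel_right₀ (phi_pos _).ne' _

lemma hasDerivAt_partialJ_snd {ρ : ℝ} (hρ : ρ ∈ Set.Ioo (-1 : ℝ) 1) {i j : ℕ} (hi : i ≤ 2)
    (hj : j < 2) (x : ℝ) {y : ℝ} (hy : y ∈ Set.Ioo (0 : ℝ) 1) :
    HasDerivAt (partialJ ρ i j x) (partialJ ρ i (j + 1) x y) y := by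
  have hswap : partialJ ρ i j x = fun y' => partialJ ρ j i y' x :=
    funext fun y' => jet_swap hρ hi (by omega) _ _
  rw [hswap]
  refine (hasDerivAt_partialJ_fst hρ hj hi hy x).congr_deriv ?_
  exact jet_swap hρ hj hi _ _

lemma continuousAt_partialJ {ρ : ℝ} (hρ : ρ ∈ Set.Ioo (-1 : ℝ) 1) {i j : ℕ} (hi : i ≤ 2)
    (hj : j ≤ 2) {x y : ℝ} (hx : x ∈ Set.Ioo (0 : ℝ) 1) (hy : y ∈ Set.Ioo (0 : ℝ) 1) :
    ContinuousAt (fun z : ℝ × ℝ × ℝ => partialJ z.1 i j z.2.1 z.2.2) (ρ, x, y) := by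
  have hx' : ContinuousAt (fun z : ℝ × ℝ × ℝ => PhiInv z.2.1) (ρ, x, y) :=
    (hasDerivAt_PhiInv hx).continuousAt.comp (f := fun z : ℝ × ℝ × ℝ => z.2.1) (by fun_prop)
  have hy' : ContinuousAt (fun z : ℝ × ℝ × ℝ => PhiInv z.2.2) (ρ, x, y) :=
    (hasDerivAt_PhiInv hy).continuousAt.comp (f := fun z : ℝ × ℝ × ℝ => z.2.2) (by fun_prop)
  exact (continuousAt_jet hρ hi hj (PhiInv x) (PhiInv y)).comp
    (f := fun z : ℝ × ℝ × ℝ => (z.1, PhiInv z.2.1, PhiInv z.2.2))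
    (continuousAt_fst.prodMk (hx'.prodMk hy'))

open Set in
lemma pdx_iterate_eqOn {F : ℝ → ℝ → ℝ} {f : ℕ → ℝ → ℝ → ℝ} {s t : Set ℝ} {n : ℕ} (hs : IsOpen s)
    (hF : ∀ x ∈ s, ∀ y ∈ t, F x y = f 0 x y)
    (hf : ∀ i < n, ∀ x ∈ s, ∀ y ∈ t, HasDerivAt (fun x' => f i x' y) (f (i + 1) x y) x) :
    ∀ i ≤ n, ∀ x ∈ s, ∀ y ∈ t, pdx^[i] F x y = f i x y := by
  intro i
  induction i with
  | zero => exact fun _ => hF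
  | succ i ih =>
    intro hi x hx y hy
    rw [Function.iterate_succ_apply', pdx, ← (hf i hi x hx y hy).deriv]
    refine Filter.EventuallyEq.deriv_eq ?_
    filter_upwards [hs.mem_nhds hx] with x' hx'
    exact ih (by omega) x' hx' y hy

open Set in
lemma pdy_iterate_eqOn {F : ℝ → ℝ → ℝ} {f : ℕ → ℝ → ℝ → ℝ} {s t : Set ℝ} {n : ℕ} (ht : IsOpen t)
    (hF : ∀ x ∈ s, ∀ y ∈ t, F x y = f 0 x y)
    (hf : ∀ j < n, ∀ x ∈ s, ∀ y ∈ t, HasDerivAt (f j x) (f (j + 1) x y) y) :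
    ∀ j ≤ n, ∀ x ∈ s, ∀ y ∈ t, pdy^[j] F x y = f j x y := by
  intro j
  induction j with
  | zero => exact fun _ => hF
  | succ j ih =>
    intro hj x hx y hy
    rw [Function.iterate_succ_apply', pdy, ← (hf j hj x hx y hy).deriv]
    refine Filter.EventuallyEq.deriv_eq ?_
    filter_upwards [ht.mem_nhds hy] with y' hy'
    exact ih (by omega) x hx y' hy'

lemma pdx_iterate_pdy_iterate_J {ρ : ℝ} (hρ : ρ ∈ Set.Ioo (-1 : ℝ) 1) {i j : ℕ} (hi : i ≤ 2)
    (hj : j ≤ 2) {x y : ℝ} (hx : x ∈ Set.Ioo (0 : ℝ) 1) (hy : y ∈ Set.Ioo (0 : ℝ) 1) :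
    pdx^[i] (pdy^[j] (J ρ)) x y = partialJ ρ i j x y := by
  have h := pdy_iterate_eqOn (f := partialJ ρ 0) (n := 2) isOpen_Ioo
    (fun x hx y hy => J_eq_bivariateCDF ρ hx hy)
    (fun j hj x _ y hy => hasDerivAt_partialJ_snd hρ (by omega) hj x hy) j hj
  exact pdx_iterate_eqOn (f := fun i => partialJ ρ i j) (n := 2) isOpen_Ioo h
    (fun i hi x hx y _ => hasDerivAt_partialJ_fst hρ hi hj hx y) i hi x hx y hy

/-! ### The approximation theorem -/

lemma Icc_subset_Ioo_zero_one {ε : ℝ} (hε : 0 < ε) {x : ℝ} (hx : x ∈ Set.Icc ε (1 - ε)) :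
    x ∈ Set.Ioo (0 : ℝ) 1 :=
  ⟨by linarith [hx.1], by linarith [hx.2]⟩

lemma exists_forall_abs_partialJ_sub_le {ρ ε δ : ℝ} (hρ : ρ ∈ Set.Ioo (-1 : ℝ) 1) (hε0 : 0 < ε)
    (hε1 : ε < 1 / 2) (hδ : 0 < δ) :
    ∃ p : MvPolynomial (Fin 2) ℝ, ∀ i ≤ 2, ∀ j ≤ 2, ∀ x ∈ Set.Icc ε (1 - ε),
      ∀ y ∈ Set.Icc ε (1 - ε),
        |partialJ ρ i j x y - pdx^[i] (pdy^[j] (polyEval p)) x y| ≤ δ := by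
  simp_rw [pdx_iterate_pdy_iterate_polyEval]
  refine exists_mvPolynomial_near_iterate_pderiv (by linarith) 2 2 (partialJ ρ) ?_ ?_ ?_ δ hδ
  · rintro i hi j hj ⟨x, y⟩ ⟨hx, hy⟩
    refine ContinuousAt.continuousWithinAt ?_
    exact (continuousAt_partialJ hρ hi hj (Icc_subset_Ioo_zero_one hε0 hx)
      (Icc_subset_Ioo_zero_one hε0 hy)).comp (f := fun z : ℝ × ℝ => (ρ, z.1, z.2)) (by fun_prop)
  · exact fun i hi j hj x hx y _ =>
      hasDerivAt_partialJ_fst hρ hi hj (Icc_subset_Ioo_zero_one hε0 hx) y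
  · exact fun i hi j hj x _ y hy =>
      hasDerivAt_partialJ_snd hρ hi hj x (Icc_subset_Ioo_zero_one hε0 hy)

lemma eventually_forall_abs_partialJ_sub_le {ρ ε δ : ℝ} (hρ : ρ ∈ Set.Ioo (-1 : ℝ) 1)
    (hε : 0 < ε) (hδ : 0 < δ) :
    ∀ᶠ ρ' in nhds ρ, ∀ i ≤ 2, ∀ j ≤ 2, ∀ x ∈ Set.Icc ε (1 - ε), ∀ y ∈ Set.Icc ε (1 - ε),
      |partialJ ρ' i j x y - partialJ ρ i j x y| ≤ δ := by
  have key : ∀ i ≤ 2, ∀ j ≤ 2, ∀ᶠ ρ' in nhds ρ,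
      ∀ z ∈ Set.Icc ε (1 - ε) ×ˢ Set.Icc ε (1 - ε),
        |partialJ ρ' i j z.1 z.2 - partialJ ρ i j z.1 z.2| ≤ δ := by
    intro i hi j hj
    refine (isCompact_Icc.prod isCompact_Icc).eventually_forall_of_forall_eventually ?_
    rintro ⟨x, y⟩ ⟨hx, hy⟩
    have hc := continuousAt_partialJ hρ hi hj (Icc_subset_Ioo_zero_one hε hx)
      (Icc_subset_Ioo_zero_one hε hy)
    have hc' := ContinuousAt.comp (x := (ρ, x, y)) (f := fun z : ℝ × ℝ × ℝ => (ρ, z.2)) hc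
      (by fun_prop)
    have h0 : ContinuousAt (fun z : ℝ × ℝ × ℝ =>
        |partialJ z.1 i j z.2.1 z.2.2 - partialJ ρ i j z.2.1 z.2.2|) (ρ, x, y) :=
      (hc.sub hc').abs
    filter_upwards [h0.eventually_le_const (by simpa using hδ)] with z hz using hz
  have key' : ∀ᶠ ρ' in nhds ρ, ∀ i ∈ Finset.range 3, ∀ j ∈ Finset.range 3,
      ∀ z ∈ Set.Icc ε (1 - ε) ×ˢ Set.Icc ε (1 - ε),
        |partialJ ρ' i j z.1 z.2 - partialJ ρ i j z.1 z.2| ≤ δ := by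
    refine (Filter.eventually_all_finset _).mpr fun i hi =>
      (Filter.eventually_all_finset _).mpr fun j hj => ?_
    exact key i (Nat.le_of_lt_succ (Finset.mem_range.mp hi)) j
      (Nat.le_of_lt_succ (Finset.mem_range.mp hj))
  filter_upwards [key'] with ρ' h i hi j hj x hx y hy
  exact h i (Finset.mem_range.mpr (by omega)) j (Finset.mem_range.mpr (by omega)) (x, y) ⟨hx, hy⟩

lemma approxJ_of_forall_abs_partialJ_sub_le {ρ ε δ : ℝ} (hρ : ρ ∈ Set.Ioo (-1 : ℝ) 1)
    (hε : 0 < ε) {p : MvPolynomial (Fin 2) ℝ}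
    (h : ∀ i ≤ 2, ∀ j ≤ 2, ∀ x ∈ Set.Icc ε (1 - ε), ∀ y ∈ Set.Icc ε (1 - ε),
      |partialJ ρ i j x y - pdx^[i] (pdy^[j] (polyEval p)) x y| ≤ δ) :
    ApproxJ ρ ε δ p := by
  intro i j hij x hx y hy
  rw [pdx_iterate_pdy_iterate_J hρ (by omega) (by omega) (Icc_subset_Ioo_zero_one hε hx)
    (Icc_subset_Ioo_zero_one hε hy)]
  exact h i (by omega) j (by omega) x hx y hy

lemma eventually_approxJ {ρ ε δ : ℝ} (hρ : ρ ∈ Set.Ioo (-1 : ℝ) 1) (hε0 : 0 < ε)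
    (hε1 : ε < 1 / 2) (hδ : 0 < δ) :
    ∃ p : MvPolynomial (Fin 2) ℝ, ∀ᶠ ρ' in nhds ρ, ApproxJ ρ' ε δ p := by
  obtain ⟨p, hp⟩ := exists_forall_abs_partialJ_sub_le hρ hε0 hε1 (half_pos hδ)
  refine ⟨p, ?_⟩
  filter_upwards [eventually_forall_abs_partialJ_sub_le hρ hε0 (half_pos hδ),
    Ioo_mem_nhds hρ.1 hρ.2] with ρ' h hρ'
  refine approxJ_of_forall_abs_partialJ_sub_le hρ' hε0 fun i hi j hj x hx y hy => ?_
  refine (abs_sub_le _ (partialJ ρ i j x y) _).trans ?_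
  linarith [h i hi j hj x hx y hy, hp i hi j hj x hx y hy]

lemma exists_abs_coeff_le {σ : Type*} (p : MvPolynomial σ ℝ) :
    ∃ K : ℝ, ∀ m, |MvPolynomial.coeff m p| ≤ K := by
  refine ⟨∑ m ∈ p.support, |p.coeff m|, fun m => ?_⟩
  by_cases hm : m ∈ p.support
  · exact Finset.single_le_sum (f := fun m => |p.coeff m|) (fun _ _ => abs_nonneg _) hm
  · rw [MvPolynomial.notMem_support_iff.mp hm, abs_zero]
    positivity

/-- **Claim B.1**: polynomial approximation of `J_ρ` up to second derivatives, with
degree and coefficient bounds depending only on `ε` and `δ` when `ρ ∈ [-1+ε, 1-ε]`. -/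
theorem poly_approx_J (ε : ℝ) (hε0 : 0 < ε) (hε1 : ε < 1 / 2) (δ : ℝ) (hδ : 0 < δ) :
    (∀ ρ : ℝ, -1 < ρ → ρ < 1 → ∃ p : MvPolynomial (Fin 2) ℝ, ApproxJ ρ ε δ p) ∧
    (∃ (D : ℕ) (K : ℝ), ∀ ρ : ℝ, -1 + ε ≤ ρ → ρ ≤ 1 - ε →
      ∃ p : MvPolynomial (Fin 2) ℝ, ApproxJ ρ ε δ p ∧
        p.totalDegree ≤ D ∧ ∀ m, |MvPolynomial.coeff m p| ≤ K) := by
  refine ⟨fun ρ h1 h2 => ?_, ?_⟩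
  · obtain ⟨p, hp⟩ := eventually_approxJ ⟨h1, h2⟩ hε0 hε1 hδ
    exact ⟨p, hp.self_of_nhds⟩
  · have hcover : ∃ (D : ℕ) (K : ℝ), ∀ ρ ∈ Set.Icc (-1 + ε) (1 - ε),
        ∃ p : MvPolynomial (Fin 2) ℝ, ApproxJ ρ ε δ p ∧
          p.totalDegree ≤ D ∧ ∀ m, |MvPolynomial.coeff m p| ≤ K := by
      refine isCompact_Icc.induction_on (p := fun s => ∃ (D : ℕ) (K : ℝ), ∀ ρ ∈ s,
        ∃ p : MvPolynomial (Fin 2) ℝ, ApproxJ ρ ε δ p ∧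
          p.totalDegree ≤ D ∧ ∀ m, |MvPolynomial.coeff m p| ≤ K) ⟨0, 0, by simp⟩ ?_ ?_ ?_
      · rintro s t hst ⟨D, K, h⟩
        exact ⟨D, K, fun ρ hρ => h ρ (hst hρ)⟩
      · rintro s t ⟨D, K, h⟩ ⟨D', K', h'⟩
        refine ⟨max D D', max K K', ?_⟩
        rintro ρ (hρ | hρ)
        · obtain ⟨p, hp, hD, hK⟩ := h ρ hρ
          exact ⟨p, hp, hD.trans (le_max_left _ _), fun m => (hK m).trans (le_max_left _ _)⟩
        · obtain ⟨p, hp, hD, hK⟩ := h' ρ hρ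
          exact ⟨p, hp, hD.trans (le_max_right _ _), fun m => (hK m).trans (le_max_right _ _)⟩
      · intro ρ hρ
        obtain ⟨p, hp⟩ := eventually_approxJ (ρ := ρ) (δ := δ)
          ⟨by linarith [hρ.1], by linarith [hρ.2]⟩ hε0 hε1 hδ
        obtain ⟨K, hK⟩ := exists_abs_coeff_le p
        exact ⟨_, mem_nhdsWithin_of_mem_nhds hp, p.totalDegree, K,
          fun ρ' hρ' => ⟨p, hρ', le_rfl, hK⟩⟩
    obtain ⟨D, K, h⟩ := hcover
    exact ⟨D, K, fun ρ h1 h2 => h ρ ⟨h1, h2⟩⟩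

end DMN
end
end
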